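/- arXiv:1509.02997 — 2 statements merged into one kernel-verified Lean document; each statement's English description precedes it below -/
import Mathlib

section
/- Let S be a left subtractive semiring. Then S is a left CP-semiring if and only if there exist a ring R and a semiring T with S isomorphic as a semiring to R × T, such that R is a semisimple ring (IsSemisimpleRing R) and T is (as a semiring) a finite Boolean algebra. -/
universe u

/-- A left CP-semiring: every cyclic left `S`-semimodule is projective. -/
def IsLeftCPSemiring (S : Type u) [Semiring S] : Prop :=
  ∀ (M : Type u) [AddCommMonoid M] [Module S M],
    (∃ m : M, Submodule.span S {m} = ⊤) → Module.Projective S M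

/-- A semiring is (as a semiring) a finite Boolean algebra: it is finite and
carries a Boolean algebra structure whose join is the addition and whose meet is
the multiplication. -/
def IsFiniteBooleanAlgebraSemiring (T : Type u) [Semiring T] : Prop :=
  Finite T ∧ ∃ _ : BooleanAlgebra T,
    (∀ a b : T, a + b = a ⊔ b) ∧ (∀ a b : T, a * b = a ⊓ b)


/-- Working form of the CP property: every left congruence is split. -/
def CongSplit (S : Type u) [Semiring S] : Prop :=
  ∀ r : S → S → Prop, Equivalence r →
    (∀ a b c d, r a b → r c d → r (a + c) (b + d)) →
    (∀ s a b, r a b → r (s * a) (s * b)) →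
    ∃ c, r c 1 ∧ ∀ x y, r x y → x * c = y * c

/-- Left subtractive. -/
def LSub (S : Type u) [Semiring S] : Prop :=
  ∀ (I : Ideal S), ∀ a ∈ I, ∀ b : S, a + b ∈ I → b ∈ I

theorem congSplit_of_cp {S : Type u} [Semiring S] (h : IsLeftCPSemiring S) : CongSplit S := by
  intro r hr hadd hmul
  let C : ModuleCon S S :=
    { r := r, iseqv := hr, add' := fun h1 h2 => hadd _ _ _ _ h1 h2,
      smul := fun s _ _ h1 => hmul s _ _ h1 }
  let f : S →ₗ[S] C.Quotient :=
    { toFun := fun x => (Quotient.mk _ x : Quotient C.toSetoid)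
      map_add' := fun _ _ => rfl
      map_smul' := fun _ _ => rfl }
  have hf : Function.Surjective f := by
    intro q
    exact Quotient.inductionOn q (fun x => ⟨x, rfl⟩)
  have hfe : ∀ x y, f x = f y ↔ r x y := by
    intro x y
    exact Quotient.eq (r := C.toSetoid)
  have hf1 : ∀ x, f x = x • f 1 := by
    intro x
    rw [← map_smul, smul_eq_mul, mul_one]
  have hproj : Module.Projective S C.Quotient := by
    apply h
    refine ⟨f 1, ?_⟩
    rw [eq_top_iff]
    intro q _
    obtain ⟨x, rfl⟩ := hf q
    rw [Submodule.mem_span_singleton]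
    exact ⟨x, (hf1 x).symm⟩
  obtain ⟨g, hg⟩ := Module.projective_lifting_property f LinearMap.id hf
  refine ⟨g (f 1), ?_, ?_⟩
  · rw [← hfe]
    exact LinearMap.congr_fun hg (f 1)
  · intro x y hxy
    rw [← hfe, hf1 x, hf1 y] at hxy
    have := congrArg g hxy
    simpa using this

theorem CongSplit.of_surj {S R : Type u} [Semiring S] [Semiring R] (h : CongSplit S)
    (f : S →+* R) (hf : Function.Surjective f) : CongSplit R := by
  intro r hr hadd hmul
  obtain ⟨c, hc1, hc2⟩ := h (fun x y => r (f x) (f y))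
    ⟨fun _ => hr.refl _, fun h => hr.symm h, fun h h' => hr.trans h h'⟩
    (fun a b c d h1 h2 => by simpa using hadd _ _ _ _ h1 h2)
    (fun s a b h1 => by simpa using hmul (f s) _ _ h1)
  refine ⟨f c, by simpa using hc1, ?_⟩
  intro x y hxy
  obtain ⟨x, rfl⟩ := hf x
  obtain ⟨y, rfl⟩ := hf y
  rw [← map_mul, ← map_mul, hc2 x y hxy]

theorem LSub.of_surj {S R : Type u} [Semiring S] [Semiring R] (h : LSub S)
    (f : S →+* R) (hf : Function.Surjective f) : LSub R := by
  intro I a ha b hab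
  obtain ⟨x, rfl⟩ := hf a
  obtain ⟨y, rfl⟩ := hf b
  have := h (I.comap f) x (by simpa using ha) y (by simpa [Ideal.mem_comap] using hab)
  simpa [Ideal.mem_comap] using this

theorem exists_ann {S : Type u} [Semiring S] (h : CongSplit S) (hs : LSub S) (I : Ideal S) :
    ∃ e : S, e * e = e ∧ (∀ x, x ∈ I ↔ x * e = 0) ∧ ∃ a ∈ I, ∃ b ∈ I, e + a = 1 + b := by
  obtain ⟨c, ⟨a, ha, b, hb, hab⟩, hc2⟩ := h (fun x y => ∃ a ∈ I, ∃ b ∈ I, x + a = y + b)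
    ⟨fun x => ⟨0, I.zero_mem, 0, I.zero_mem, rfl⟩,
      fun ⟨a, ha, b, hb, hab⟩ => ⟨b, hb, a, ha, hab.symm⟩,
      fun {x y z} ⟨a, ha, b, hb, hab⟩ ⟨a', ha', b', hb', hab'⟩ =>
        ⟨a + a', I.add_mem ha ha', b' + b, I.add_mem hb' hb, by
          rw [← add_assoc, hab, add_right_comm, hab', add_assoc]⟩⟩
    (fun x y z w ⟨a, ha, b, hb, hab⟩ ⟨a', ha', b', hb', hab'⟩ =>
        ⟨a + a', I.add_mem ha ha', b + b', I.add_mem hb hb', by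
          rw [add_add_add_comm, hab, hab', add_add_add_comm]⟩)
    (fun s x y ⟨a, ha, b, hb, hab⟩ =>
      ⟨s * a, I.mul_mem_left s ha, s * b, I.mul_mem_left s hb, by rw [← mul_add, hab, mul_add]⟩)
  refine ⟨c, ?_, ?_, a, ha, b, hb, hab⟩
  · simpa using hc2 c 1 ⟨a, ha, b, hb, hab⟩
  · intro x
    constructor
    · intro hx
      simpa using hc2 x 0 ⟨0, I.zero_mem, x, hx, by simp⟩
    · intro hx
      have h1 : x * a = x * b + x := by
        have := congrArg (x * ·) hab
        simp only [mul_add, hx, zero_add, mul_one] at this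
        rw [this, add_comm]
      exact hs I (x * b) (I.mul_mem_left x hb) x (h1 ▸ I.mul_mem_left x ha)

theorem semisimple_of_congSplit {R : Type u} [Ring R] (h : CongSplit R) (hs : LSub R) :
    IsSemisimpleRing R := by
  refine (isSemisimpleModule_iff R R).2 ⟨fun I => ?_⟩
  obtain ⟨e, he, hI, a, ha, b, hb, hab⟩ := exists_ann h hs I
  refine ⟨Ideal.span {e}, ?_⟩
  rw [isCompl_iff, Submodule.disjoint_def, codisjoint_iff]
  constructor
  · intro x hx hxe
    obtain ⟨y, rfl⟩ := Ideal.mem_span_singleton'.1 hxe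
    rw [hI, mul_assoc, he] at hx
    exact hx
  · rw [eq_top_iff]
    intro x _
    rw [Submodule.mem_sup]
    refine ⟨x * (1 - e), ?_, x * e, Ideal.mul_mem_left _ _ (Ideal.mem_span_singleton_self e), ?_⟩
    · rw [hI, mul_assoc, sub_mul, he]
      simp
    · rw [← mul_add]
      simp

theorem left_inv_of_one_le {T : Type u} [IdemSemiring T] (h : CongSplit T) (hs : LSub T)
    {u : T} (hu : 1 ≤ u) : ∃ b, b * u = 1 := by
  obtain ⟨e, he, hI, a, ha, b, hb, hab⟩ := exists_ann h hs (Ideal.span {u})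
  have h1 : u * e = 0 := (hI u).1 (Ideal.mem_span_singleton_self u)
  have h2 : e = 0 := by
    have : 1 * e ≤ u * e := mul_le_mul_left hu e
    rw [h1, one_mul] at this
    exact le_antisymm this (zero_le)
  have h3 : (1 : T) ∈ Ideal.span {u} := by
    rw [hI, h2, mul_zero]
  exact Ideal.mem_span_singleton'.1 h3

theorem right_inv_of_one_le {T : Type u} [IdemSemiring T] (h : CongSplit T) (hs : LSub T)
    {u : T} (hu : 1 ≤ u) : ∃ b, u * b = 1 := by
  obtain ⟨b, hb⟩ := left_inv_of_one_le h hs hu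
  have key : ∀ x y : T, ∀ n m : ℕ, x * u ^ n = y * u ^ n → x * u ^ (n + m) = y * u ^ (n + m) := by
    intro x y n m hxy
    rw [pow_add, ← mul_assoc, ← mul_assoc, hxy]
  obtain ⟨c, ⟨n, hn⟩, hc⟩ := h (fun x y => ∃ n : ℕ, x * u ^ n = y * u ^ n)
    ⟨fun x => ⟨0, rfl⟩, fun ⟨n, hn⟩ => ⟨n, hn.symm⟩, fun {x y z} ⟨n, hn⟩ ⟨m, hm⟩ =>
      ⟨n + m, by rw [key _ _ n m hn, add_comm n m, key _ _ m n hm]⟩⟩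
    (fun x y z w ⟨n, hn⟩ ⟨m, hm⟩ =>
      ⟨n + m, by rw [add_mul, add_mul, key _ _ n m hn, add_comm n m, key _ _ m n hm]⟩)
    (fun s x y ⟨n, hn⟩ => ⟨n, by rw [mul_assoc, hn, mul_assoc]⟩)
  rw [one_mul] at hn
  have hbn : b ^ n * u ^ n = 1 := by
    clear hn
    induction n with
    | zero => simp
    | succ k ih =>
      rw [pow_succ, pow_succ', mul_assoc, ← mul_assoc b u, hb, one_mul, ih]
  refine ⟨b, ?_⟩
  -- right multiplication by u is injective
  have h1 : (u * b * b ^ n) * c = (1 * b ^ n) * c := by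
    apply hc
    refine ⟨n + 1, ?_⟩
    rw [pow_succ, ← mul_assoc, ← mul_assoc, mul_assoc _ (b ^ n), hbn, mul_assoc _ (b ^ n), hbn]
    simp [mul_assoc, hb]
  have h2 := congrArg (· * u ^ n) h1
  simp only [mul_assoc, hn, hbn] at h2
  simpa using h2

theorem le_one_of_congSplit {T : Type u} [IdemSemiring T] (h : CongSplit T) (hs : LSub T)
    (a : T) : a ≤ 1 := by
  set u : T := 1 + a with hu
  have h1u : 1 ≤ u := by rw [hu, add_eq_sup]; exact le_sup_left
  have hau : a ≤ u := by rw [hu, add_eq_sup]; exact le_sup_right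
  have hpow : ∀ n : ℕ, 1 ≤ u ^ n := fun n => one_le_pow_of_one_le' h1u n
  have key : ∀ x y : T, ∀ n m : ℕ, x ≤ y * u ^ n → x ≤ y * u ^ (n + m) := by
    intro x y n m hxy
    rw [pow_add, ← mul_assoc]
    calc x ≤ y * u ^ n * 1 := by rwa [mul_one]
      _ ≤ _ := mul_le_mul_right (hpow m) _
  let le' : T → T → Prop := fun x y => ∃ n : ℕ, x ≤ y * u ^ n
  have lrefl : ∀ x, le' x x := fun x => ⟨0, by simp⟩
  have ltrans : ∀ x y z, le' x y → le' y z → le' x z := by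
    rintro x y z ⟨n, hn⟩ ⟨m, hm⟩
    refine ⟨m + n, hn.trans ?_⟩
    rw [pow_add, ← mul_assoc]
    exact mul_le_mul_left hm _
  have ladd : ∀ x y z w, le' x y → le' z w → le' (x + z) (y + w) := by
    rintro x y z w ⟨n, hn⟩ ⟨m, hm⟩
    refine ⟨n + m, ?_⟩
    rw [add_mul]
    apply add_le_add (key _ _ _ _ hn)
    rw [add_comm n m]
    exact key _ _ _ _ hm
  have lmul : ∀ s x y, le' x y → le' (s * x) (s * y) := by
    rintro s x y ⟨n, hn⟩
    exact ⟨n, by rw [mul_assoc]; exact mul_le_mul_right hn _⟩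
  obtain ⟨c, ⟨⟨n, hn⟩, ⟨m, hm⟩⟩, hc⟩ := h (fun x y => le' x y ∧ le' y x)
    ⟨fun x => ⟨lrefl x, lrefl x⟩, fun h => ⟨h.2, h.1⟩,
      fun h h' => ⟨ltrans _ _ _ h.1 h'.1, ltrans _ _ _ h'.2 h.2⟩⟩
    (fun x y z w h h' => ⟨ladd _ _ _ _ h.1 h'.1, ladd _ _ _ _ h.2 h'.2⟩)
    (fun s x y h => ⟨lmul _ _ _ h.1, lmul _ _ _ h.2⟩)
  have huc : u * c = 1 * c := hc u 1 ⟨⟨1, by simp⟩, ⟨0, by simpa using h1u⟩⟩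
  obtain ⟨w, hw⟩ := right_inv_of_one_le h hs hm
  have h3 : u = 1 := by
    calc u = u * (c * u ^ m * w) := by rw [hw, mul_one]
      _ = (u * c) * u ^ m * w := by simp only [mul_assoc]
      _ = 1 := by rw [huc, one_mul, hw]
  rw [h3] at hau
  exact hau

theorem finiteBoolean_of_congSplit {T : Type u} [IdemSemiring T] (h : CongSplit T) (hs : LSub T) :
    IsFiniteBooleanAlgebraSemiring T := by
  have le1 := le_one_of_congSplit h hs
  have one_add' : ∀ a : T, 1 + a = 1 := fun a => by rw [add_eq_sup, sup_eq_left.2 (le1 a)]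
  have mul_le_l : ∀ a b : T, a * b ≤ a := fun a b => by
    simpa using mul_le_mul_right (le1 b) a
  have mul_le_r : ∀ a b : T, a * b ≤ b := fun a b => by
    simpa using mul_le_mul_left (le1 a) b
  have ann : ∀ I : Ideal T, ∃ e b : T, b ∈ I ∧ e + b = 1 ∧ ∀ x ∈ I, x * e = 0 := by
    intro I
    obtain ⟨e, he, hI, a, ha, b, hb, hab⟩ := exists_ann h hs I
    exact ⟨e, a, ha, by rw [hab, one_add'], fun x hx => (hI x).1 hx⟩
  have idem : ∀ a : T, a * a = a := by
    intro a
    obtain ⟨e, p, hp, hep, hann⟩ := ann (Ideal.span {a})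
    obtain ⟨x, rfl⟩ := Ideal.mem_span_singleton'.1 hp
    have hae := hann a (Ideal.mem_span_singleton_self a)
    have h1 : a * (x * a) = a := by
      have := congrArg (a * ·) hep
      simpa [mul_add, hae] using this
    have h2 : x * a = a := by
      apply le_antisymm (mul_le_r x a)
      conv_lhs => rw [← h1]
      exact mul_le_r _ _
    rw [h2] at h1
    exact h1
  have compl : ∀ a : T, ∃ e : T, a * e = 0 ∧ 1 ≤ a + e := by
    intro a
    obtain ⟨e, p, hp, hep, hann⟩ := ann (Ideal.span {a})
    refine ⟨e, hann a (Ideal.mem_span_singleton_self a), ?_⟩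
    obtain ⟨x, rfl⟩ := Ideal.mem_span_singleton'.1 hp
    rw [← hep, add_comm]
    exact add_le_add_left (mul_le_r _ _) _
  choose cpl hc0 hc1 using compl
  have le_mul : ∀ x y z : T, x ≤ y → x ≤ z → x ≤ y * z := by
    intro x y z h1 h2
    rw [← idem x]
    exact mul_le_mul' h1 h2
  let L : Lattice T :=
    { (inferInstance : SemilatticeSup T) with
      inf := fun a b => a * b
      inf_le_left := mul_le_l
      inf_le_right := mul_le_r
      le_inf := le_mul }
  let D : DistribLattice T := @DistribLattice.ofInfSupLe T L (by
    intro a b c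
    change a * (b ⊔ c) ≤ a * b ⊔ a * c
    rw [← add_eq_sup, ← add_eq_sup, mul_add])
  let B : BooleanAlgebra T :=
    { D with
      compl := cpl
      top := 1
      bot := 0
      inf_compl_le_bot := fun x => (hc0 x).le
      top_le_sup_compl := fun x => by
        have := hc1 x
        rw [add_eq_sup] at this
        exact this
      le_top := le1
      bot_le := fun x => zero_le }
  refine ⟨?_, B, fun a b => add_eq_sup a b, fun a b => rfl⟩
  have hnoeth : IsNoetherian T T := by
    rw [isNoetherian_def]
    intro I
    obtain ⟨e, b, hb, heb, hann⟩ := ann I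
    refine ⟨{b}, ?_⟩
    apply le_antisymm
    · rw [Submodule.span_le]
      simpa using hb
    · intro x hx
      have : x = x * b := by
        have := congrArg (x * ·) heb
        simpa [mul_add, hann x hx] using this.symm
      rw [this]
      exact Submodule.smul_mem _ x (Submodule.subset_span (by simp))
  have hwf : WellFoundedGT (Ideal T) := inferInstance
  have hmem : ∀ x a : T, x ∈ Ideal.span {a} → x ≤ a := by
    intro x a hx
    obtain ⟨y, rfl⟩ := Ideal.mem_span_singleton'.1 hx
    exact mul_le_r _ _
  have hmono : StrictMono (fun a : T => Ideal.span {a}) := by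
    intro a b hab
    refine lt_of_le_of_ne ?_ ?_
    · rw [Ideal.span_singleton_le_iff_mem, Ideal.mem_span_singleton']
      refine ⟨a, le_antisymm (mul_le_l _ _) (le_mul _ _ _ le_rfl hab.le)⟩
    · intro heq
      have heq' : Ideal.span {a} = Ideal.span {b} := heq
      have : b ∈ Ideal.span {a} := heq' ▸ Ideal.mem_span_singleton_self b
      exact absurd (hmem _ _ this) (not_le_of_gt hab)
  have hT : WellFoundedGT T := hmono.wellFoundedGT
  have hfin : ∀ x : T, (Set.Iic xᶜ).Finite := by
    intro x
    induction x using WellFoundedGT.induction with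
    | ind x ih =>
    by_cases hex : ∃ y, ⊥ < y ∧ y < xᶜ
    · obtain ⟨y, hy0, hy⟩ := hex
      have f1 : (Set.Iic y).Finite := by
        have := ih yᶜ (lt_of_le_of_ne (le_compl_comm.1 hy.le) (by
          rintro rfl
          exact hy.ne (compl_compl y).symm))
        rwa [compl_compl] at this
      have f2 : (Set.Iic (xᶜ ⊓ yᶜ)).Finite := by
        have := ih (x ⊔ y) (lt_of_le_of_ne le_sup_left (by
          intro hh
          have h1 : y ≤ x := by rw [hh]; exact le_sup_right
          have : y ≤ ⊥ := by
            rw [← inf_compl_eq_bot (a := x)]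
            exact le_inf h1 hy.le
          exact absurd this (not_le_of_gt hy0)))
        rwa [compl_sup] at this
      refine (Set.Finite.image2 (fun a b => a ⊔ b) f1 f2).subset ?_
      intro z hz
      refine ⟨z ⊓ y, inf_le_right, z ⊓ yᶜ, ?_, ?_⟩
      · exact le_inf (inf_le_left.trans hz) inf_le_right
      · change (z ⊓ y) ⊔ (z ⊓ yᶜ) = z
        rw [← inf_sup_left, sup_compl_eq_top, inf_top_eq]
    · refine (Set.toFinite ({⊥, xᶜ} : Set T)).subset ?_
      intro z hz
      by_contra hcon
      simp only [Set.mem_insert_iff, Set.mem_singleton_iff, not_or] at hcon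
      exact hex ⟨z, lt_of_le_of_ne (B.bot_le z) (Ne.symm hcon.1), lt_of_le_of_ne hz hcon.2⟩
  have := hfin ⊥
  rw [compl_bot, Set.Iic_top] at this
  exact Set.finite_univ_iff.1 this

theorem exists_decomp {S : Type u} [Semiring S] (h : CongSplit S) (hs : LSub S) :
    ∃ c v w : S, c + c = c ∧ v + w = 0 ∧ c + v = 1 ∧ c * c = c ∧ v * v = v ∧
      (∀ s, c * s * v = 0) ∧ (∀ s, v * s * c = 0) := by
  let le' : S → S → Prop := fun x y => ∃ (n : ℕ) (z : S), x + z = n • y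
  have lrefl : ∀ x, le' x x := fun x => ⟨1, 0, by simp⟩
  have ltrans : ∀ x y z, le' x y → le' y z → le' x z := by
    rintro x y z ⟨n, a, hn⟩ ⟨m, b, hm⟩
    refine ⟨n * m, a + n • b, ?_⟩
    rw [← add_assoc, hn, ← smul_add, hm, mul_smul]
  have ladd : ∀ x y z w, le' x y → le' z w → le' (x + z) (y + w) := by
    rintro x y z w ⟨n, a, hn⟩ ⟨m, b, hm⟩
    refine ⟨n + m, a + b + m • y + n • w, ?_⟩
    have : x + z + (a + b + m • y + n • w) = (x + a) + (z + b) + m • y + n • w := by abel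
    rw [this, hn, hm, smul_add, add_smul, add_smul]
    abel
  have lmul : ∀ s x y, le' x y → le' (s * x) (s * y) := by
    rintro s x y ⟨n, a, hn⟩
    exact ⟨n, s * a, by rw [← mul_add, hn, mul_smul_comm]⟩
  obtain ⟨c, ⟨hc1, ⟨n, z, hz⟩⟩, hc⟩ := h (fun x y => le' x y ∧ le' y x)
    ⟨fun x => ⟨lrefl x, lrefl x⟩, fun h => ⟨h.2, h.1⟩,
      fun h h' => ⟨ltrans _ _ _ h.1 h'.1, ltrans _ _ _ h'.2 h.2⟩⟩
    (fun x y z w h h' => ⟨ladd _ _ _ _ h.1 h'.1, ladd _ _ _ _ h.2 h'.2⟩)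
    (fun s x y h => ⟨lmul _ _ _ h.1, lmul _ _ _ h.2⟩)
  have hcc : c + c = c := by
    have := hc (1 + 1) 1 ⟨⟨2, 0, by simp [two_smul]⟩, ⟨1, 1, by simp⟩⟩
    simpa [add_mul] using this
  have hV : ∀ x y : S, x + y = 0 → x * c = 0 := by
    intro x y hxy
    have := hc x 0 ⟨⟨0, y, by simpa using hxy⟩, ⟨1, x, by simp⟩⟩
    simpa using this
  let V : Ideal S :=
    { carrier := {x | ∃ y, x + y = 0}
      zero_mem' := ⟨0, by simp⟩
      add_mem' := by
        rintro a b ⟨y, hy⟩ ⟨w, hw⟩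
        exact ⟨y + w, by rw [add_add_add_comm, hy, hw, add_zero]⟩
      smul_mem' := by
        rintro s a ⟨y, hy⟩
        exact ⟨s * y, by rw [smul_eq_mul, ← mul_add, hy, mul_zero]⟩ }
  obtain ⟨e, he, hI, -⟩ := exists_ann h hs (Ideal.span {c} ⊔ V)
  have hce : c * e = 0 :=
    (hI c).1 (Submodule.mem_sup_left (Ideal.mem_span_singleton_self c))
  have heV : e ∈ V := by
    refine ⟨z * e, ?_⟩
    have := congrArg (· * e) hz
    simpa [add_mul, mul_assoc, hce] using this
  have he0 : e = 0 := by
    rw [← he]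
    exact (hI e).1 (Submodule.mem_sup_right heV)
  have h1 : (1 : S) ∈ Ideal.span {c} ⊔ V := by rw [hI, he0, mul_zero]
  obtain ⟨y, hy, v, ⟨w, hvw⟩, hyv⟩ := Submodule.mem_sup.1 h1
  obtain ⟨b, rfl⟩ := Ideal.mem_span_singleton'.1 hy
  have hvc : v * c = 0 := hV v w hvw
  have hcidem : c * c = c := by
    simpa using hc c 1 ⟨hc1, ⟨n, z, hz⟩⟩
  have hbc : b * c = c := by
    have := congrArg (· * c) hyv
    simpa [add_mul, hvc, mul_assoc, hcidem] using this
  rw [hbc] at hyv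
  have canc : ∀ x y : S, x + y = 0 → x + x = x → x = 0 := by
    intro x y h1 h2
    calc x = x + (x + y) := by rw [h1, add_zero]
      _ = 0 := by rw [← add_assoc, h2, h1]
  have hcv : ∀ s, c * s * v = 0 := by
    intro s
    apply canc _ (c * s * w)
    · rw [← mul_add, hvw, mul_zero]
    · rw [← add_mul, ← add_mul, hcc]
  have hvv : v * v = v := by
    have := congrArg (v * ·) hyv
    simpa [mul_add, hvc] using this
  refine ⟨c, v, w, hcc, hvw, hyv, hcidem, hvv, hcv, ?_⟩
  intro s
  exact hV (v * s) (w * s) (by rw [← add_mul, hvw, zero_mul])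

theorem forward {S : Type u} [Semiring S] (h : CongSplit S) (hs : LSub S) :
    ∃ (R : Type u) (T : Type u) (_ : Ring R) (_ : Semiring T),
        Nonempty (S ≃+* R × T) ∧
        IsSemisimpleRing R ∧
        IsFiniteBooleanAlgebraSemiring T := by
  obtain ⟨c, v, w, hcc, hvw, hcv1, hc, hv, hcsv, hvsc⟩ := exists_decomp h hs
  have hc' : IsIdempotentElem c := hc
  have hv' : IsIdempotentElem v := hv
  have hcv : c * v = 0 := by simpa using hcsv 1
  have hvc : v * c = 0 := by simpa using hvsc 1
  have hdec : ∀ s, v * s * v + c * s * c = s := by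
    intro s
    calc v * s * v + c * s * c = (c + v) * s * (c + v) := by
          simp [add_mul, mul_add, hcsv, hvsc, add_comm]
      _ = s := by rw [hcv1, one_mul, mul_one]
  have hmulv : ∀ x y, v * (x * y) * v = v * x * v * (v * y * v) := by
    intro x y
    have h1 : v * x = v * x * v := by
      calc v * x = v * x * (c + v) := by rw [hcv1, mul_one]
        _ = _ := by rw [mul_add, hvsc, zero_add]
    calc v * (x * y) * v = (v * x) * (y * v) := by simp only [mul_assoc]
      _ = (v * x * v) * (y * v) := by rw [← h1]
      _ = (v * x * (v * v)) * (y * v) := by rw [hv]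
      _ = _ := by simp only [mul_assoc]
  have hmulc : ∀ x y, c * (x * y) * c = c * x * c * (c * y * c) := by
    intro x y
    have h1 : c * x = c * x * c := by
      calc c * x = c * x * (c + v) := by rw [hcv1, mul_one]
        _ = _ := by rw [mul_add, hcsv, add_zero]
    calc c * (x * y) * c = (c * x) * (y * c) := by simp only [mul_assoc]
      _ = (c * x * c) * (y * c) := by rw [← h1]
      _ = (c * x * (c * c)) * (y * c) := by rw [hc]
      _ = _ := by simp only [mul_assoc]
  let E : S ≃+* hv'.Corner × hc'.Corner :=
    { toFun := fun s => (⟨v * s * v, s, rfl⟩, ⟨c * s * c, s, rfl⟩)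
      invFun := fun p => p.1.1 + p.2.1
      left_inv := hdec
      right_inv := by
        rintro ⟨⟨_, a, rfl⟩, ⟨_, b, rfl⟩⟩
        refine Prod.ext (Subtype.ext ?_) (Subtype.ext ?_)
        · change v * (v * a * v + c * b * c) * v = v * a * v
          have h1 : v * (v * a * v) * v = (v * v) * a * (v * v) := by simp only [mul_assoc]
          have h2 : v * (c * b * c) * v = (v * c) * b * (c * v) := by simp only [mul_assoc]
          rw [mul_add, add_mul, h1, h2, hv, hvc, zero_mul, zero_mul, add_zero]
        · change c * (v * a * v + c * b * c) * c = c * b * c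
          have h1 : c * (c * b * c) * c = (c * c) * b * (c * c) := by simp only [mul_assoc]
          have h2 : c * (v * a * v) * c = (c * v) * a * (v * c) := by simp only [mul_assoc]
          rw [mul_add, add_mul, h1, h2, hc, hcv, zero_mul, zero_mul, zero_add]
      map_mul' := fun x y => Prod.ext (Subtype.ext (hmulv x y)) (Subtype.ext (hmulc x y))
      map_add' := fun x y => Prod.ext
        (Subtype.ext (by change v * (x + y) * v = v * x * v + v * y * v; rw [mul_add, add_mul]))
        (Subtype.ext (by change c * (x + y) * c = c * x * c + c * y * c; rw [mul_add, add_mul])) }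
  have hnegR : ∀ x : hv'.Corner, ∃ y, y + x = 0 := by
    rintro ⟨_, a, rfl⟩
    refine ⟨⟨v * (w * a) * v, w * a, rfl⟩, Subtype.ext ?_⟩
    change v * (w * a) * v + v * a * v = 0
    have : v * a * v = v * (v * a) * v := by rw [← mul_assoc v v a, hv]
    rw [this, ← add_mul, ← mul_add, ← add_mul, add_comm w v, hvw]
    simp
  choose ng hng using hnegR
  letI : Neg hv'.Corner := ⟨ng⟩
  let RR : Ring hv'.Corner :=
    { (inferInstance : Semiring hv'.Corner) with
      neg := ng
      zsmul := zsmulRec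
      neg_add_cancel := hng }
  let f1 : S →+* hv'.Corner := (RingHom.fst _ _).comp (E : S →+* hv'.Corner × hc'.Corner)
  let f2 : S →+* hc'.Corner := (RingHom.snd _ _).comp (E : S →+* hv'.Corner × hc'.Corner)
  have hf1 : Function.Surjective f1 := Prod.fst_surjective.comp E.surjective
  have hf2 : Function.Surjective f2 := Prod.snd_surjective.comp E.surjective
  refine ⟨hv'.Corner, hc'.Corner, RR, inferInstance, ⟨E⟩, ?_, ?_⟩
  · exact semisimple_of_congSplit (h.of_surj f1 hf1) (hs.of_surj f1 hf1)
  · letI : IdemSemiring hc'.Corner := IdemSemiring.ofSemiring (by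
      rintro ⟨_, a, rfl⟩
      refine Subtype.ext ?_
      change c * a * c + c * a * c = c * a * c
      rw [← add_mul, ← add_mul, hcc])
    exact finiteBoolean_of_congSplit (T := hc'.Corner) (h.of_surj f2 hf2) (hs.of_surj f2 hf2)

theorem cp_of_split {S : Type u} [Semiring S]
    (h : ∀ (M : Type u) [AddCommMonoid M] [Module S M] (m : M),
      ∃ c : S, c • m = m ∧ ∀ s t : S, s • m = t • m → s * c = t * c) : IsLeftCPSemiring S := by
  intro M _ _ ⟨m, hm⟩
  obtain ⟨c, hc, hst⟩ := h M m
  have hex : ∀ x : M, ∃ s : S, s • m = x := by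
    intro x
    rw [← Submodule.mem_span_singleton, hm]
    trivial
  choose k hk using hex
  let g : M →ₗ[S] S :=
    { toFun := fun x => k x * c
      map_add' := fun x y => by
        rw [← add_mul]
        apply hst
        rw [add_smul, hk, hk, hk]
      map_smul' := fun s x => by
        rw [RingHom.id_apply, smul_eq_mul, ← mul_assoc]
        apply hst
        rw [mul_smul, hk, hk] }
  refine Module.Projective.of_split g (LinearMap.toSpanSingleton S M m) ?_
  ext x
  change (k x * c) • m = x
  rw [mul_smul, hc, hk]

theorem backward {S R T : Type u} [Semiring S] [Ring R] [Semiring T] (E : S ≃+* R × T)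
    (hR : IsSemisimpleRing R) (hT : IsFiniteBooleanAlgebraSemiring T) : IsLeftCPSemiring S := by
  obtain ⟨hfin, B, hadd, hmul⟩ := hT
  apply cp_of_split
  intro M _ _ m
  let q : R × T → S := E.symm
  have qadd : ∀ a b, q (a + b) = q a + q b := fun a b => map_add E.symm a b
  have qmul : ∀ a b, q (a * b) = q a * q b := fun a b => map_mul E.symm a b
  have q0 : q 0 = 0 := map_zero E.symm
  have q1 : q 1 = 1 := map_one E.symm
  have hqE : ∀ s, q (E s) = s := fun s => E.symm_apply_apply s
  have zero_bot : (0 : T) = ⊥ := by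
    have := hadd 0 ⊥
    rw [zero_add, sup_bot_eq] at this
    exact this.symm
  have one_top : (1 : T) = ⊤ := by
    have := hmul 1 ⊤
    rw [one_mul, inf_top_eq] at this
    exact this.symm
  -- ring part
  let I : Ideal R :=
    { carrier := {r | q (r, 0) • m = 0}
      zero_mem' := by
        change q 0 • m = 0
        rw [q0, zero_smul]
      add_mem' := by
        intro a b ha hb
        have : ((a + b, 0) : R × T) = (a, 0) + (b, 0) := by simp
        change q (a + b, 0) • m = 0
        rw [this, qadd, add_smul, ha, hb, add_zero]
      smul_mem' := by
        intro s a ha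
        have : ((s * a, 0) : R × T) = (s, 0) * (a, 0) := by simp
        change q (s * a, 0) • m = 0
        rw [this, qmul, mul_smul, ha, smul_zero] }
  have hI : ∀ r, r ∈ I ↔ q (r, 0) • m = 0 := fun r => Iff.rfl
  obtain ⟨J, hJ⟩ := exists_isCompl I
  obtain ⟨i, hi, j, hj, hij⟩ := Submodule.mem_sup.1
    ((hJ.sup_eq_top ▸ Submodule.mem_top : (1 : R) ∈ I ⊔ J))
  have hIj : ∀ x ∈ I, x * j = 0 := by
    intro x hx
    have h1 : x * j ∈ J := J.smul_mem x hj
    have h2 : x * j ∈ I := by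
      have : x * j = x - x * i := by
        rw [eq_sub_iff_add_eq, ← mul_add, add_comm, hij, mul_one]
      rw [this]
      exact I.sub_mem hx (I.smul_mem x hi)
    exact (Submodule.disjoint_def.1 hJ.disjoint) _ h2 h1
  -- Boolean part
  let P : T → Prop := fun t => q (0, t) • m = 0
  have hPadd : ∀ a b, P a → P b → P (a ⊔ b) := by
    intro a b ha hb
    have : ((0, a ⊔ b) : R × T) = (0, a) + (0, b) := by simp [hadd]
    change q (0, a ⊔ b) • m = 0
    rw [this, qadd, add_smul, ha, hb, add_zero]
  have hP0 : P ⊥ := by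
    change q (0, ⊥) • m = 0
    rw [← zero_bot]
    change q 0 • m = 0
    rw [q0, zero_smul]
  obtain ⟨d, hPd, hd⟩ : ∃ d, P d ∧ ∀ x, P x → x ≤ d := by
    obtain ⟨d, hd⟩ := Set.Finite.exists_maximal (Set.toFinite {t | P t}) ⟨⊥, hP0⟩
    refine ⟨d, hd.1, fun x hx => ?_⟩
    exact le_sup_right.trans (hd.2 (hPadd d x hd.1 hx) le_sup_left)
  have hhalf : ∀ s t : T, q (0, s) • m = q (0, t) • m → s * dᶜ ≤ t * dᶜ := by
    intro s t hst
    have h1 : P (tᶜ ⊓ s) := by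
      have e1 : ((0, tᶜ ⊓ s) : R × T) = (0, tᶜ) * (0, s) := by simp [hmul]
      have e2 : ((0, tᶜ) : R × T) * (0, t) = 0 := by
        refine Prod.ext (by simp) ?_
        change tᶜ * t = 0
        rw [hmul, compl_inf_eq_bot, zero_bot]
      change q (0, tᶜ ⊓ s) • m = 0
      rw [e1, qmul, mul_smul, hst, ← mul_smul, ← qmul, e2, q0, zero_smul]
    have h2 := hd _ h1
    rw [hmul, hmul]
    refine le_inf ?_ inf_le_right
    have h3 : s ≤ t ⊔ d := by
      calc s = (t ⊓ s) ⊔ (tᶜ ⊓ s) := by rw [← inf_sup_right, sup_compl_eq_top, top_inf_eq]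
        _ ≤ t ⊔ d := sup_le_sup inf_le_left h2
    calc s ⊓ dᶜ ≤ (t ⊔ d) ⊓ dᶜ := inf_le_inf_right _ h3
      _ = t ⊓ dᶜ := by rw [inf_sup_right, inf_compl_eq_bot, sup_bot_eq]
      _ ≤ t := inf_le_left
  refine ⟨q (j, dᶜ), ?_, ?_⟩
  · have e1 : (1 : R × T) = (j, dᶜ) + ((i, 0) + (0, d)) := by
      refine Prod.ext ?_ ?_
      · change 1 = j + (i + 0)
        rw [add_zero, add_comm, hij]
      · change 1 = dᶜ + (0 + d)
        rw [zero_add, hadd, compl_sup_eq_top, one_top]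
    have hPd' : q (0, d) • m = 0 := hPd
    calc q (j, dᶜ) • m = q (j, dᶜ) • m + (q (i, 0) • m + q (0, d) • m) := by
          rw [(hI i).1 hi, hPd', add_zero, add_zero]
      _ = q 1 • m := by rw [e1, qadd, qadd, add_smul, add_smul]
      _ = m := by rw [q1, one_smul]
  · intro s t hst
    obtain ⟨⟨s1, s2⟩, rfl⟩ := E.symm.surjective s
    obtain ⟨⟨t1, t2⟩, rfl⟩ := E.symm.surjective t
    change q (s1, s2) • m = q (t1, t2) • m at hst
    change q (s1, s2) * q (j, dᶜ) = q (t1, t2) * q (j, dᶜ)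
    have hA : ∀ a b, q (a, 0) • q (s1, s2) • m = q (a, 0) • q (t1, t2) • m ∧
        q (0, b) • q (s1, s2) • m = q (0, b) • q (t1, t2) • m := by
      intro a b
      rw [hst]
      exact ⟨rfl, rfl⟩
    have hB := hA 1 1
    simp only [← mul_smul, ← qmul, Prod.mk_mul_mk, one_mul, zero_mul] at hB
    rw [← qmul, ← qmul, Prod.mk_mul_mk, Prod.mk_mul_mk]
    congr 2
    · rw [← sub_eq_zero, ← sub_mul]
      apply hIj
      rw [hI]
      have e1 : ((s1 - t1, 0) : R × T) = (s1, 0) + (-t1, 0) := by simp [sub_eq_add_neg]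
      have e2 : ((t1, 0) : R × T) + (-t1, 0) = 0 := by
        refine Prod.ext ?_ ?_ <;> simp
      rw [e1, qadd, add_smul, hB.1, ← add_smul, ← qadd, e2, q0, zero_smul]
    · exact le_antisymm (hhalf _ _ hB.2) (hhalf _ _ hB.2.symm)

/-- a left subtractive semiring is a left CP-semiring iff it is
isomorphic to `R × T` with `R` a semisimple ring and `T` a finite Boolean
algebra. -/
theorem leftSubtractive_isLeftCPSemiring_iff
    (S : Type u) [Semiring S]
    (hsub : ∀ (I : Ideal S), ∀ a ∈ I, ∀ b : S, a + b ∈ I → b ∈ I) :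
    IsLeftCPSemiring S ↔
      ∃ (R : Type u) (T : Type u) (_ : Ring R) (_ : Semiring T),
        Nonempty (S ≃+* R × T) ∧
        IsSemisimpleRing R ∧
        IsFiniteBooleanAlgebraSemiring T := by
  constructor
  · intro h
    exact forward (congSplit_of_cp h) hsub
  · rintro ⟨R, T, _, _, ⟨E⟩, hR, hT⟩
    exact backward E hR hT
end

section
/- Let S be a left subtractive semiring. The following are equivalent: (1) S is a congruence-simple left CP-semiring; (2) S is an ideal-simple left CP-semiring; (3) there exist n ≥ 1 and a division ring D with S isomorphic as a semiring to Matrix (Fin n) (Fin n) D, or S is isomorphic to the Boolean semifield B. -/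
universe u

/-- A semiring is congruence-simple if it is nontrivial and its only semiring
congruences are the diagonal one and the universal one. -/
def IsCongruenceSimple (S : Type u) [Semiring S] : Prop :=
  Nontrivial S ∧ ∀ c : RingCon S, c = ⊥ ∨ c = ⊤

/-- A semiring is ideal-simple if it is nontrivial and its only two-sided ideals
(additive submonoids closed under left and right multiplication) are `0` and `S`. -/
def IsIdealSimple (S : Type u) [Semiring S] : Prop :=
  Nontrivial S ∧ ∀ I : AddSubmonoid S,
    (∀ a ∈ I, ∀ s : S, s * a ∈ I ∧ a * s ∈ I) → I = ⊥ ∨ I = ⊤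

/-- `S` is (isomorphic to) the Boolean semifield `B = {0, 1}` with `1 + 1 = 1`. -/
def IsBooleanSemifield (S : Type u) [Semiring S] : Prop :=
  (∀ x : S, x = 0 ∨ x = 1) ∧ (0 : S) ≠ 1 ∧ (1 : S) + 1 = 1

/-! ### The ring case -/

/-- A semiring with additive inverses is a ring. -/
noncomputable abbrev ringOfNeg (S : Type u) [inst : Semiring S] (h : ∀ x : S, ∃ y, x + y = 0) :
    Ring S :=
  { inst with
    neg := fun x => Classical.choose (h x)
    zsmul := @zsmulRec S _ _ ⟨fun x => Classical.choose (h x)⟩ (fun n x => n • x)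
    zsmul_zero' := fun a => zero_nsmul a
    zsmul_succ' := fun n a => succ_nsmul a n
    zsmul_neg' := fun _ _ => rfl
    neg_add_cancel := fun x => by
      rw [add_comm]; exact Classical.choose_spec (h x) }

theorem ring_simple_of_ideal (R : Type u) [Ring R] (h : IsIdealSimple R) : IsSimpleRing R := by
  rw [isSimpleRing_iff_isTwoSided_imp]
  refine ⟨h.1, fun I hI => ?_⟩
  rcases h.2 I.toAddSubmonoid (fun a ha s => ⟨I.mul_mem_left s ha, I.mul_mem_right s ha⟩) with h | h
  · left; ext x; exact SetLike.ext_iff.1 h x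
  · right; ext x; exact SetLike.ext_iff.1 h x

theorem ring_ideal_of_simple (R : Type u) [Ring R] (h : IsSimpleRing R) : IsIdealSimple R := by
  rw [isSimpleRing_iff_isTwoSided_imp] at h
  refine ⟨h.1, fun I hI => ?_⟩
  let J : Ideal R := { I with smul_mem' := fun s a ha => (hI a ha s).1 }
  rcases h.2 J ⟨fun b ha => (hI _ ha b).2⟩ with h | h
  · left; ext x; exact SetLike.ext_iff.1 h x
  · right; ext x; exact SetLike.ext_iff.1 h x

theorem ring_simple_of_cong (R : Type u) [Ring R] (h : IsCongruenceSimple R) : IsSimpleRing R := by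
  have := h.1
  constructor
  have : Nontrivial (TwoSidedIdeal R) := inferInstance
  refine { eq_bot_or_eq_top := fun I => ?_ }
  rcases h.2 I.ringCon with h | h
  · left; exact TwoSidedIdeal.orderIsoRingCon.injective (h.trans (map_bot TwoSidedIdeal.orderIsoRingCon).symm)
  · right; exact TwoSidedIdeal.orderIsoRingCon.injective (h.trans (map_top TwoSidedIdeal.orderIsoRingCon).symm)

theorem ring_cong_of_simple (R : Type u) [Ring R] (h : IsSimpleRing R) : IsCongruenceSimple R := by
  refine ⟨(isSimpleRing_iff_isTwoSided_imp.1 h).1, fun c => ?_⟩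
  rcases h.simple.eq_bot_or_eq_top (TwoSidedIdeal.orderIsoRingCon.symm c) with h | h
  · left; rw [OrderIso.symm_apply_eq] at h; rw [h]; exact map_bot _
  · right; rw [OrderIso.symm_apply_eq] at h; rw [h]; exact map_top _

theorem ring_semisimple_of_CP (R : Type u) [Ring R] (h : IsLeftCPSemiring R) :
    IsSemisimpleRing R := by
  refine { exists_isCompl := fun I => ?_ }
  have hp : Module.Projective R (R ⧸ I) := by
    refine h _ ⟨I.mkQ 1, ?_⟩
    rw [eq_top_iff]
    rintro x -
    obtain ⟨x, rfl⟩ := I.mkQ_surjective x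
    rw [Submodule.mem_span_singleton]
    exact ⟨x, by rw [← map_smul, smul_eq_mul, mul_one]⟩
  obtain ⟨g, hg⟩ := Module.projective_lifting_property I.mkQ LinearMap.id I.mkQ_surjective
  have hg' : ∀ x, I.mkQ (g x) = x := fun x => LinearMap.congr_fun hg x
  have hid : IsIdempotentElem (g ∘ₗ I.mkQ) := by
    refine LinearMap.ext fun x => ?_
    simp only [Module.End.mul_apply, LinearMap.comp_apply, hg']
  have hk : LinearMap.ker (g ∘ₗ I.mkQ) = I := by
    rw [LinearMap.ker_comp_of_ker_eq_bot, Submodule.ker_mkQ]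
    exact LinearMap.ker_eq_bot.2 (Function.LeftInverse.injective hg')
  have := (LinearMap.IsIdempotentElem.isCompl hid).symm
  rw [hk] at this
  exact ⟨_, this⟩

theorem ring_CP_of_semisimple (R : Type u) [Ring R] (h : IsSemisimpleRing R) :
    IsLeftCPSemiring R := by
  intro M _ _ _
  let _ := Module.addCommMonoidToAddCommGroup R (M := M)
  exact Module.projective_of_isSemisimpleRing R M

theorem ring_matrix (R : Type u) [Ring R] (h : IsSimpleRing R) (hCP : IsLeftCPSemiring R) :
    ∃ (n : ℕ) (_ : 1 ≤ n) (D : Type u) (_ : DivisionRing D),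
          Nonempty (R ≃+* Matrix (Fin n) (Fin n) D) := by
  have := ring_semisimple_of_CP R hCP
  obtain ⟨n, hn, D, hD, e⟩ := IsSimpleRing.exists_ringEquiv_matrix_divisionRing R
  exact ⟨n, Nat.one_le_iff_ne_zero.2 hn.1, D, hD, e⟩

theorem ring_of_matrix (R : Type u) [Ring R] (n : ℕ) (hn : 1 ≤ n) (D : Type u) [DivisionRing D]
    (e : R ≃+* Matrix (Fin n) (Fin n) D) : IsSimpleRing R ∧ IsSemisimpleRing R := by
  have : NeZero n := ⟨by omega⟩
  have : IsSimpleRing (Matrix (Fin n) (Fin n) D) := inferInstance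
  exact ⟨IsSimpleRing.of_ringEquiv e.symm this, e.symm.isSemisimpleRing⟩

/-! ### The Boolean semifield -/

theorem bool_CP (S : Type u) [Semiring S] (h : IsBooleanSemifield S) : IsLeftCPSemiring S := by
  rintro M _ _ ⟨m, hm⟩
  have hs : ∀ x : M, ∃ s : S, s • m = x := fun x =>
    Submodule.mem_span_singleton.1 (hm ▸ Submodule.mem_top)
  by_cases h0 : m = 0
  · have : Subsingleton M := ⟨fun x y => by
      obtain ⟨a, rfl⟩ := hs x
      obtain ⟨b, rfl⟩ := hs y
      simp [h0]⟩
    infer_instance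
  · refine Module.Projective.of_equiv (LinearEquiv.ofBijective (LinearMap.toSpanSingleton S M m) ⟨?_, ?_⟩)
    · intro a b hab
      simp only [LinearMap.toSpanSingleton_apply] at hab
      rcases h.1 a with rfl | rfl <;> rcases h.1 b with rfl | rfl
      · rfl
      · simp at hab; exact absurd hab.symm h0
      · simp at hab; exact absurd hab h0
      · rfl
    · intro x
      obtain ⟨a, rfl⟩ := hs x
      exact ⟨a, rfl⟩

theorem bool_ideal (S : Type u) [Semiring S] (h : IsBooleanSemifield S) : IsIdealSimple S := by
  refine ⟨⟨0, 1, h.2.1⟩, fun I hI => ?_⟩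
  by_cases h1 : (1 : S) ∈ I
  · right; rw [eq_top_iff]; intro x _; simpa using (hI 1 h1 x).1
  · left; rw [eq_bot_iff]; intro x hx
    rcases h.1 x with rfl | rfl
    · simp
    · exact absurd hx h1

theorem bool_cong (S : Type u) [Semiring S] (h : IsBooleanSemifield S) : IsCongruenceSimple S := by
  refine ⟨⟨0, 1, h.2.1⟩, fun c => ?_⟩
  by_cases h1 : c 0 1
  · right; rw [eq_top_iff]; intro x y _
    rcases h.1 x with rfl | rfl <;> rcases h.1 y with rfl | rfl
    · exact c.refl _
    · exact h1
    · exact c.symm h1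
    · exact c.refl _
  · left; rw [eq_bot_iff]; intro x y hxy
    show x = y
    rcases h.1 x with rfl | rfl <;> rcases h.1 y with rfl | rfl
    · rfl
    · exact absurd hxy h1
    · exact absurd (c.symm hxy) h1
    · rfl

/-! ### The zerosumfree case -/

/-- In a left CP-semiring every left congruence is the kernel of right multiplication by an
idempotent. -/
theorem CP_congruence (S : Type u) [Semiring S] (hCP : IsLeftCPSemiring S)
    (r : S → S → Prop) (hr : Equivalence r)
    (hadd : ∀ a b c d, r a b → r c d → r (a + c) (b + d))
    (hmul : ∀ s a b, r a b → r (s * a) (s * b)) :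
    ∃ e : S, e * e = e ∧ ∀ x y, r x y ↔ x * e = y * e := by
  let c : ModuleCon S S :=
    { r := r
      iseqv := hr
      add' := fun h1 h2 => hadd _ _ _ _ h1 h2
      smul := fun s _ _ h => hmul s _ _ h }
  let q : S →ₗ[S] c.Quotient :=
    { toFun := fun x => Quotient.mk c.toSetoid x
      map_add' := fun _ _ => rfl
      map_smul' := fun _ _ => rfl }
  have hq : ∀ x y, q x = q y ↔ r x y := fun x y => Quotient.eq (r := c.toSetoid)
  have hqs : Function.Surjective q := Quotient.mk_surjective
  have : Module.Projective S c.Quotient := by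
    refine hCP _ ⟨q 1, ?_⟩
    rw [eq_top_iff]
    rintro x -
    obtain ⟨x, rfl⟩ := hqs x
    rw [Submodule.mem_span_singleton]
    exact ⟨x, by rw [← map_smul, smul_eq_mul, mul_one]⟩
  obtain ⟨g, hg⟩ := Module.projective_lifting_property q LinearMap.id hqs
  have hg' : ∀ x, q (g x) = x := fun x => LinearMap.congr_fun hg x
  have hx : ∀ x, g (q x) = x * g (q 1) := fun x => by
    rw [← smul_eq_mul, ← map_smul, ← map_smul, smul_eq_mul, mul_one]
  refine ⟨g (q 1), ?_, fun x y => ?_⟩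
  · rw [← hx, hg']
  · rw [← hx, ← hx, ← hq]
    exact ⟨fun h => by rw [h], fun h => by rw [← hg' (q x), h, hg']⟩

/-- Archimedean preorder. -/
def arch {S : Type u} [Semiring S] (x y : S) : Prop := ∃ (n : ℕ) (z : S), x + z = n • y

section
variable {S : Type u} [Semiring S]

theorem arch_refl (x : S) : arch x x := ⟨1, 0, by simp⟩

theorem arch_trans {x y t : S} (h1 : arch x y) (h2 : arch y t) : arch x t := by
  obtain ⟨n, z, h1⟩ := h1
  obtain ⟨m, w, h2⟩ := h2
  exact ⟨n * m, z + n • w, by rw [← add_assoc, h1, ← nsmul_add, h2, mul_nsmul']⟩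

theorem arch_add {x y a b : S} (h1 : arch x y) (h2 : arch a b) : arch (x + a) (y + b) := by
  obtain ⟨n, z, h1⟩ := h1
  obtain ⟨m, w, h2⟩ := h2
  refine ⟨n + m, z + w + m • y + n • b, ?_⟩
  calc x + a + (z + w + m • y + n • b) = (x + z) + (a + w) + m • y + n • b := by abel
    _ = n • y + m • b + m • y + n • b := by rw [h1, h2]
    _ = (n + m) • (y + b) := by rw [nsmul_add, add_nsmul, add_nsmul]; abel

theorem arch_mul {x y a b : S} (h1 : arch x y) (h2 : arch a b) : arch (x * a) (y * b) := by
  obtain ⟨n, z, h1⟩ := h1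
  obtain ⟨m, w, h2⟩ := h2
  refine ⟨n * m, x * w + z * (a + w), ?_⟩
  calc x * a + (x * w + z * (a + w)) = (x + z) * (a + w) := by
        rw [add_mul, mul_add x, add_assoc]
    _ = (n * m) • (y * b) := by rw [h1, h2, smul_mul_smul_comm]

theorem arch_two (x : S) : arch (x + x) x := ⟨2, 0, by rw [two_nsmul, add_zero]⟩
theorem arch_two' (x : S) : arch x (x + x) := ⟨1, x, by simp⟩

/-- the archimedean congruence -/
def archCon (S : Type u) [Semiring S] : RingCon S where
  r x y := arch x y ∧ arch y x
  iseqv := ⟨fun x => ⟨arch_refl x, arch_refl x⟩, fun h => ⟨h.2, h.1⟩,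
    fun h h' => ⟨arch_trans h.1 h'.1, arch_trans h'.2 h.2⟩⟩
  add' h h' := ⟨arch_add h.1 h'.1, arch_add h.2 h'.2⟩
  mul' h h' := ⟨arch_mul h.1 h'.1, arch_mul h.2 h'.2⟩

theorem arch_zero (hz : ∀ a b : S, a + b = 0 → a = 0) {x : S} (h : arch x 0) : x = 0 := by
  obtain ⟨n, z, h⟩ := h
  exact hz x z (by simpa using h)

theorem idem_of_cong (hz : ∀ a b : S, a + b = 0 → a = 0) (h : IsCongruenceSimple S) (x : S) :
    x + x = x := by
  have := h.1
  rcases h.2 (archCon S) with h | h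
  · have h1 : archCon S (x + x) x := ⟨arch_two x, arch_two' x⟩
    rw [h] at h1
    exact h1
  · have h1 : archCon S 1 0 := by rw [h]; trivial
    exact absurd (arch_zero hz h1.1) one_ne_zero

theorem idem_of_ideal (hz : ∀ a b : S, a + b = 0 → a = 0) (h : IsIdealSimple S)
    (hCP : IsLeftCPSemiring S) (x : S) : x + x = x := by
  have := h.1
  obtain ⟨e, he, hr⟩ := CP_congruence S hCP (fun x y => archCon S x y) (archCon S).iseqv
    (fun a b c d h1 h2 => (archCon S).add h1 h2)
    (fun s a b h1 => (archCon S).mul ((archCon S).refl s) h1)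
  have he2 : e + e = e := by
    have := (hr (1 + 1) 1).1 ⟨arch_two 1, arch_two' 1⟩
    rwa [add_mul, one_mul] at this
  have he0 : e ≠ 0 := by
    rintro rfl
    have := (hr 1 0).2 (by simp)
    exact one_ne_zero (arch_zero hz this.1)
  let I : AddSubmonoid S :=
    { carrier := {a | a + a = a}
      zero_mem' := by simp
      add_mem' := fun {a b} (ha : a + a = a) (hb : b + b = b) => by
        show a + b + (a + b) = a + b
        rw [add_add_add_comm, ha, hb] }
  rcases h.2 I (fun a (ha : a + a = a) s => ⟨show _ + _ = _ by rw [← mul_add, ha],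
    show _ + _ = _ by rw [← add_mul, ha]⟩) with h | h
  · have : e ∈ I := he2
    rw [h] at this
    exact absurd this he0
  · have : x ∈ I := by rw [h]; trivial
    exact this

theorem key (hsub : ∀ (I : Ideal S), ∀ a ∈ I, ∀ b : S, a + b ∈ I → b ∈ I)
    (hz : ∀ a b : S, a + b = 0 → a = 0) [Nontrivial S] (hCP : IsLeftCPSemiring S)
    (hid : ∀ x : S, x + x = x) :
    ∃ (I : Ideal S) (e : S), I.IsMaximal ∧ e ≠ 0 ∧ e * e = e ∧ (∀ x, x * e = 0 ↔ x ∈ I) ∧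
      ∀ x, x * e = 0 ∨ x * e = e := by
  have hst : ∀ (I : Ideal S) (a b : S), a + b ∈ I ↔ a ∈ I ∧ b ∈ I := by
    intro I a b
    refine ⟨fun h => ⟨?_, ?_⟩, fun h => I.add_mem h.1 h.2⟩
    · exact hsub I (a + b) h a (by rwa [add_right_comm, hid])
    · exact hsub I (a + b) h b (by rwa [add_assoc, hid])
  obtain ⟨I, hI⟩ := Ideal.exists_maximal S
  obtain ⟨e, he, hr⟩ := CP_congruence S hCP (fun x y => ∀ s, s * x ∈ I ↔ s * y ∈ I)
    ⟨fun x s => Iff.rfl, fun h s => (h s).symm, fun h h' s => (h s).trans (h' s)⟩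
    (fun a b c d h1 h2 s => by rw [mul_add, mul_add, hst, hst, h1, h2])
    (fun t a b h1 s => by rw [← mul_assoc, ← mul_assoc, h1])
  have hk : ∀ x, x * e = 0 ↔ x ∈ I := by
    intro x
    have := hr x 0
    rw [zero_mul] at this
    rw [← this]
    simp only [mul_zero, Submodule.zero_mem, iff_true]
    exact ⟨fun h => by simpa using h 1, fun h s => I.mul_mem_left s h⟩
  have h1I : (1 : S) ∉ I := fun h => hI.ne_top ((Ideal.eq_top_iff_one I).2 h)
  have he0 : e ≠ 0 := by
    rintro rfl
    exact h1I ((hk 1).1 (by simp))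
  refine ⟨I, e, hI, he0, he, hk, fun x => ?_⟩
  by_contra hx
  push Not at hx
  -- `M = S e` is simple
  have hsimp : ∀ z, z * e = z → z ≠ 0 → ∃ p, p * z = e := by
    intro z hz1 hz0
    have hzI : z ∉ I := fun h => hz0 (by rw [← hz1]; exact (hk z).2 h)
    have : (1 : S) ∈ I ⊔ Ideal.span {z} := by
      refine (Ideal.isMaximal_iff.1 hI).2 _ z le_sup_left hzI ?_
      exact Ideal.mem_sup_right (Ideal.mem_span_singleton_self z)
    obtain ⟨i, hi, w, hw, hiw⟩ := Submodule.mem_sup.1 this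
    obtain ⟨p, rfl⟩ := Ideal.mem_span_singleton'.1 hw
    refine ⟨p, ?_⟩
    have h2 : (i + p * z) * e = e := by rw [hiw, one_mul]
    rwa [add_mul, (hk i).2 hi, zero_add, mul_assoc, hz1] at h2
  -- equality is detected by annihilators
  have hann : ∀ a b, a * e = a → b * e = b → (∀ s, s * a = 0 ↔ s * b = 0) → a = b := by
    intro a b ha hb h
    rw [← ha, ← hb]
    refine (hr a b).1 fun s => ?_
    rw [← hk, ← hk, mul_assoc, mul_assoc, ha, hb, h]
  set y := x * e with hy
  have hye : y * e = y := by rw [hy, mul_assoc, he]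
  by_cases hcase : ∀ t, t * e = 0 → t * y = 0
  · -- the annihilator of `y` contains `I`, so they agree
    apply hx.2
    refine hann y e hye he fun s => ⟨fun hs => ?_, hcase s⟩
    by_contra hse
    have hsI : s ∉ I := fun h => hse ((hk s).2 h)
    let J : Ideal S := LinearMap.ker (LinearMap.toSpanSingleton S S y)
    have hJ : ∀ t, t ∈ J ↔ t * y = 0 := fun t => by simp [J]
    have := (Ideal.isMaximal_iff.1 hI).2 J s
      (fun t ht => (hJ t).2 (hcase t ((hk t).2 ht))) hsI ((hJ s).2 hs)
    rw [hJ, one_mul] at this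
    exact hx.1 this
  · push Not at hcase
    obtain ⟨t, hte, hty⟩ := hcase
    obtain ⟨p, hp⟩ := hsimp (t * y) (by rw [mul_assoc, hye]) hty
    set s := p * t with hs
    have hse : s * e = 0 := by rw [hs, mul_assoc, hte, mul_zero]
    have hsy : s * y = e := by rw [hs, mul_assoc, hp]
    have hmem : s ∈ Ideal.span {e + s} :=
      ((hst _ e s).1 (Ideal.mem_span_singleton_self (e + s))).2
    obtain ⟨v, hv⟩ := Ideal.mem_span_singleton'.1 hmem
    have hve : v * e = 0 := by
      refine hz _ (v * s * e) ?_
      calc v * e + v * s * e = (v * (e + s)) * e := by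
            rw [mul_add, add_mul, mul_assoc v e e, he]
        _ = 0 := by rw [hv, hse]
    rw [mul_add, hve, zero_add] at hv
    apply he0
    rw [← hsy, ← hv, mul_assoc, hsy, hve]

theorem bool_of_cong (hsub : ∀ (I : Ideal S), ∀ a ∈ I, ∀ b : S, a + b ∈ I → b ∈ I)
    (hz : ∀ a b : S, a + b = 0 → a = 0) (h : IsCongruenceSimple S) (hCP : IsLeftCPSemiring S) :
    IsBooleanSemifield S := by
  have := h.1
  have hid := idem_of_cong hz h
  obtain ⟨I, e, hI, he0, he, hk, hx⟩ := key hsub hz hCP hid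
  refine ⟨?_, zero_ne_one, hid 1⟩
  let c : RingCon S :=
    { r := fun x y => x * e = y * e
      iseqv := ⟨fun _ => rfl, fun h => h.symm, fun h h' => h.trans h'⟩
      add' := fun {a b c d} (h1 : a * e = b * e) (h2 : c * e = d * e) => by
        show (a + c) * e = (b + d) * e
        rw [add_mul, add_mul, h1, h2]
      mul' := fun {a b c d} (h1 : a * e = b * e) (h2 : c * e = d * e) => by
        show (a * c) * e = (b * d) * e
        rw [mul_assoc, mul_assoc, h2]
        rcases hx d with h | h <;> rw [h]
        · simp
        · exact h1 }
  have hc : ∀ x y, c x y ↔ x * e = y * e := fun _ _ => Iff.rfl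
  rcases h.2 c with h | h
  · intro x
    have hinj : ∀ y, x * e = y * e → x = y := fun y hxy => by
      have := (hc x y).2 hxy
      rw [h] at this
      exact this
    rcases hx x with h | h
    · left; exact hinj 0 (by rw [h, zero_mul])
    · right; exact hinj 1 (by rw [h, one_mul])
  · have : c 1 0 := by rw [h]; trivial
    rw [hc, one_mul, zero_mul] at this
    exact absurd this he0

theorem bool_of_ideal (hsub : ∀ (I : Ideal S), ∀ a ∈ I, ∀ b : S, a + b ∈ I → b ∈ I)
    (hz : ∀ a b : S, a + b = 0 → a = 0) (h : IsIdealSimple S) (hCP : IsLeftCPSemiring S) :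
    IsBooleanSemifield S := by
  have := h.1
  have hid := idem_of_ideal hz h hCP
  obtain ⟨I, e, hI, he0, he, hk, hx⟩ := key hsub hz hCP hid
  refine ⟨?_, zero_ne_one, hid 1⟩
  have h1I : (1 : S) ∉ I := fun h => hI.ne_top ((Ideal.eq_top_iff_one I).2 h)
  have hmem : ∀ x, x ∈ I → x = 0 := by
    rcases h.2 I.toAddSubmonoid (fun a ha s => ⟨I.mul_mem_left s ha, by
      show a * s ∈ I
      have ha' : a * e = 0 := (hk a).2 ha
      rw [← hk, mul_assoc]
      rcases hx s with h | h <;> rw [h]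
      · simp
      · exact ha'⟩) with h | h
    · intro x hx
      have : x ∈ I.toAddSubmonoid := hx
      rw [h] at this
      exact this
    · exact absurd (show (1 : S) ∈ I.toAddSubmonoid by rw [h]; trivial) h1I
  have hp : (1 : S) ∈ Ideal.span {e} := by
    refine (Ideal.isMaximal_iff.1 hI).2 _ e (fun x hx => ?_) (fun h => he0 (hmem e h))
      (Ideal.mem_span_singleton_self e)
    rw [hmem x hx]; exact Submodule.zero_mem _
  obtain ⟨p, hp⟩ := Ideal.mem_span_singleton'.1 hp
  have he1 : e = 1 := by
    calc e = p * e * e := by rw [hp, one_mul]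
      _ = 1 := by rw [mul_assoc, he, hp]
  intro x
  simpa [he1] using hx x

theorem dich_ideal (h : IsIdealSimple S) :
    (∀ x : S, ∃ y, x + y = 0) ∨ (∀ a b : S, a + b = 0 → a = 0) := by
  let I : AddSubmonoid S :=
    { carrier := {a | ∃ b, a + b = 0}
      zero_mem' := ⟨0, by simp⟩
      add_mem' := by
        rintro a b ⟨a', ha⟩ ⟨b', hb⟩
        exact ⟨a' + b', by rw [add_add_add_comm, ha, hb, add_zero]⟩ }
  have hI : ∀ a, a ∈ I ↔ ∃ b, a + b = 0 := fun _ => Iff.rfl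
  rcases h.2 I (by
    rintro a ⟨b, hb⟩ s
    exact ⟨⟨s * b, by rw [← mul_add, hb, mul_zero]⟩, ⟨b * s, by rw [← add_mul, hb, zero_mul]⟩⟩)
    with h | h
  · right
    intro a b hab
    have : a ∈ I := ⟨b, hab⟩
    rw [h] at this
    exact this
  · left
    intro x
    rw [← hI, h]; trivial

theorem dich_cong (h : IsCongruenceSimple S) :
    (∀ x : S, ∃ y, x + y = 0) ∨ (∀ a b : S, a + b = 0 → a = 0) := by
  let c : RingCon S :=
    { r := fun x y => ∃ a b, a + b = 0 ∧ x + a = y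
      iseqv := by
        refine ⟨fun x => ⟨0, 0, by simp, by simp⟩, ?_, ?_⟩
        · rintro x y ⟨a, b, hab, rfl⟩
          exact ⟨b, a, by rw [add_comm, hab], by rw [add_assoc, hab, add_zero]⟩
        · rintro x y z ⟨a, b, hab, rfl⟩ ⟨a', b', hab', rfl⟩
          exact ⟨a + a', b + b', by rw [add_add_add_comm, hab, hab', add_zero],
            by rw [add_assoc]⟩
      add' := by
        rintro x y z w ⟨a, b, hab, rfl⟩ ⟨a', b', hab', rfl⟩
        exact ⟨a + a', b + b', by rw [add_add_add_comm, hab, hab', add_zero],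
            by rw [add_add_add_comm]⟩
      mul' := by
        rintro x y z w ⟨a, b, hab, rfl⟩ ⟨a', b', hab', rfl⟩
        refine ⟨x * a' + a * (z + a'), x * b' + b * (z + a'), ?_, ?_⟩
        · rw [add_add_add_comm, ← mul_add, ← add_mul, hab, hab', mul_zero, zero_mul, add_zero]
        · rw [← add_assoc, ← mul_add, ← add_mul] }
  have hc : ∀ x y, c x y ↔ ∃ a b, a + b = 0 ∧ x + a = y := fun _ _ => Iff.rfl
  rcases h.2 c with h | h
  · right
    intro a b hab
    have : c 0 a := (hc _ _).2 ⟨a, b, hab, zero_add a⟩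
    rw [h] at this
    exact Eq.symm this
  · left
    intro x
    have : c x 0 := by rw [h]; trivial
    obtain ⟨a, b, -, h⟩ := (hc _ _).1 this
    exact ⟨a, h⟩

theorem three_to (h : (∃ (n : ℕ) (_ : 1 ≤ n) (D : Type u) (_ : DivisionRing D),
          Nonempty (S ≃+* Matrix (Fin n) (Fin n) D)) ∨ IsBooleanSemifield S) :
    IsCongruenceSimple S ∧ IsIdealSimple S ∧ IsLeftCPSemiring S := by
  rcases h with ⟨n, hn, D, hD, ⟨e⟩⟩ | h
  · have hneg : ∀ x : S, ∃ y, x + y = 0 := fun x =>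
      ⟨e.symm (-(e x)), e.injective (by simp)⟩
    let _ := ringOfNeg S hneg
    obtain ⟨h1, h2⟩ := ring_of_matrix S n hn D e
    exact ⟨ring_cong_of_simple S h1, ring_ideal_of_simple S h1, ring_CP_of_semisimple S h2⟩
  · exact ⟨bool_cong S h, bool_ideal S h, bool_CP S h⟩

end

/-- for a left subtractive semiring `S`, the following are
equivalent: (1) `S` is a congruence-simple left CP-semiring; (2) `S` is an
ideal-simple left CP-semiring; (3) `S ≅ Mₙ(D)` for a division ring `D` and
`n ≥ 1`, or `S ≅ B`. -/
theorem leftSubtractive_congruenceSimple_iff_idealSimple_CP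
    (S : Type u) [Semiring S]
    (hsub : ∀ (I : Ideal S), ∀ a ∈ I, ∀ b : S, a + b ∈ I → b ∈ I) :
    ((IsCongruenceSimple S ∧ IsLeftCPSemiring S) ↔
      (IsIdealSimple S ∧ IsLeftCPSemiring S)) ∧
    ((IsIdealSimple S ∧ IsLeftCPSemiring S) ↔
      ((∃ (n : ℕ) (_ : 1 ≤ n) (D : Type u) (_ : DivisionRing D),
          Nonempty (S ≃+* Matrix (Fin n) (Fin n) D)) ∨
        IsBooleanSemifield S)) := by
  have h13 : IsCongruenceSimple S ∧ IsLeftCPSemiring S →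
      ((∃ (n : ℕ) (_ : 1 ≤ n) (D : Type u) (_ : DivisionRing D),
          Nonempty (S ≃+* Matrix (Fin n) (Fin n) D)) ∨ IsBooleanSemifield S) := by
    rintro ⟨h, hCP⟩
    rcases dich_cong h with hneg | hz
    · left
      let _ := ringOfNeg S hneg
      exact ring_matrix S (ring_simple_of_cong S h) hCP
    · exact Or.inr (bool_of_cong hsub hz h hCP)
  have h23 : IsIdealSimple S ∧ IsLeftCPSemiring S →
      ((∃ (n : ℕ) (_ : 1 ≤ n) (D : Type u) (_ : DivisionRing D),
          Nonempty (S ≃+* Matrix (Fin n) (Fin n) D)) ∨ IsBooleanSemifield S) := by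
    rintro ⟨h, hCP⟩
    rcases dich_ideal h with hneg | hz
    · left
      let _ := ringOfNeg S hneg
      exact ring_matrix S (ring_simple_of_ideal S h) hCP
    · exact Or.inr (bool_of_ideal hsub hz h hCP)
  exact ⟨⟨fun h => (three_to (h13 h)).2, fun h => ⟨(three_to (h23 h)).1, h.2⟩⟩,
    ⟨h23, fun h => (three_to h).2⟩⟩
end
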